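/- Let ℓ, r, n be positive integers with ℓ + r < n. The graph compl_n(K_{ℓ,r}) (the n-vertex complement of the complete bipartite graph K_{ℓ,r}) is ensnaring if and only if n − ℓ − r is odd and (ℓ, r) ≠ (1, 1). -/

import Mathlib

open scoped Classical

/-- The state space `Ξₙ` for a graph on vertex set `V` with `n = |V|`: a state `(v, i, ε)`
consists of a bijection `v` from the vertices to the positions `ℤ/n` (the replica of vertex
`a` sits at position `v a`; positions increase clockwise), the index `i : ℤ/n`, and the
orientation `ε ∈ {±1}` encoded as a `Bool` (`true` = `+1`, `false` = `-1`). -/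
abbrev Xi (V : Type*) [Fintype V] : Type _ :=
  (V ≃ ZMod (Fintype.card V)) × ZMod (Fintype.card V) × Bool

/-- The orientation `ε` as an element of `ℤ/n`. -/
def epsZ (n : ℕ) (e : Bool) : ZMod n := if e then 1 else -1

/-- Refractive toric promotion `Θ_G`:
`Θ_G (v,i,ε) = (s̄ᵢ v, i+ε, ε)` if `{v⁻¹(i), v⁻¹(i+1)}` is not an edge of `G`, and
`Θ_G (v,i,ε) = (s̄ᵢ v, i−ε, −ε)` if it is an edge of `G`.  Here `s̄ᵢ v` swaps the replicas
sitting at positions `i` and `i+1`. -/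
noncomputable def theta {V : Type*} [Fintype V] (G : SimpleGraph V) (D : Xi V) : Xi V :=
  if G.Adj (D.1.symm D.2.1) (D.1.symm (D.2.1 + 1)) then
    (D.1.trans (Equiv.swap D.2.1 (D.2.1 + 1)), D.2.1 - epsZ _ D.2.2, !D.2.2)
  else
    (D.1.trans (Equiv.swap D.2.1 (D.2.1 + 1)), D.2.1 + epsZ _ D.2.2, D.2.2)

/-- The net number of clockwise steps that the replica of vertex `a` makes during one
application of `Θ_G` to the state `D`: each application swaps the replicas at positions
`i` and `i+1`, moving the former one step clockwise and the latter one step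
counterclockwise. -/
def disp {V : Type*} [Fintype V] (D : Xi V) (a : V) : ℤ :=
  if D.1 a = D.2.1 then 1 else if D.1 a = D.2.1 + 1 then -1 else 0

/-- `n` times the winding number `w_O(a)` of vertex `a` with respect to the orbit `O` of the
state `D` under `Θ_G`: the net number of clockwise steps made by the replica of `a` during
`P` consecutive applications of `Θ_G` starting from `D`, where `P` is the size of the orbit
(i.e. the minimal period of `D`).  The winding number itself is `windSum G D a / n`; in
particular `w_O(a) = 0` iff `windSum G D a = 0`, and `w_O(a) = w_O(b)` iff
`windSum G D a = windSum G D b`. -/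
noncomputable def windSum {V : Type*} [Fintype V] (G : SimpleGraph V) (D : Xi V) (a : V) : ℤ :=
  ∑ k ∈ Finset.range (Function.minimalPeriod (theta G) D), disp ((theta G)^[k] D) a

/-- The winding vector of the orbit of `D` under `Θ_G` is zero. -/
def WindingVectorZero {V : Type*} [Fintype V] (G : SimpleGraph V) (D : Xi V) : Prop :=
  ∀ a : V, windSum G D a = 0

/-- `G` is ensnaring if every orbit of `Θ_G` has winding vector `0`. -/
def Ensnaring {V : Type*} [Fintype V] (G : SimpleGraph V) : Prop :=
  ∀ D : Xi V, WindingVectorZero G D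

/-- `G` is expelling if no orbit of `Θ_G` has winding vector `0`. -/
def Expelling {V : Type*} [Fintype V] (G : SimpleGraph V) : Prop :=
  ∀ D : Xi V, ¬ WindingVectorZero G D

/-- The graph `H` (on `Fin m`) viewed as a graph on `Fin n` (for `m ≤ n`) by adding
isolated vertices. -/
def spread (m n : ℕ) (H : SimpleGraph (Fin m)) : SimpleGraph (Fin n) :=
  SimpleGraph.fromRel (fun a b =>
    ∃ (ha : (a : ℕ) < m) (hb : (b : ℕ) < m), H.Adj ⟨(a : ℕ), ha⟩ ⟨(b : ℕ), hb⟩)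

/-- The `n`-vertex complement `compl_n(H)` of an `m`-vertex graph `H`: the `n`-vertex graph
whose complement is the disjoint union of `H` with `n - m` isolated vertices. -/
def compln (m n : ℕ) (H : SimpleGraph (Fin m)) : SimpleGraph (Fin n) :=
  (spread m n H)ᶜ

/-- The complete bipartite graph `K_{ℓ,r}` on `Fin (ℓ + r)`, with partite sets
`{0, …, ℓ-1}` and `{ℓ, …, ℓ+r-1}`. -/
def bipartiteGraph (l r : ℕ) : SimpleGraph (Fin (l + r)) :=
  SimpleGraph.fromRel (fun a b => (a : ℕ) < l ∧ l ≤ (b : ℕ))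


abbrev Ty := Option Bool

def passB : Ty → Ty → Bool
  | some x, some y => x != y
  | _, _ => false

def stepF : List Ty → List Ty
  | a :: b :: r => if passB a b then a :: (r ++ [b]) else b :: (r.reverse ++ [a])
  | w => w

def Coll : List Ty → Prop
  | a :: b :: _ => a = b
  | _ => False

def Collides (w : List Ty) : Prop := ∃ t, Coll (stepF^[t] w)

lemma Collides.of_step {w : List Ty} (h : Collides (stepF w)) : Collides w := by
  obtain ⟨t, ht⟩ := h
  exact ⟨t + 1, by simpa [Function.iterate_succ] using ht⟩

lemma Collides.of_eq {a : Ty} {r : List Ty} : Collides (a :: a :: r) := ⟨0, rfl⟩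

lemma stepF_perm (w : List Ty) : (stepF w).Perm w := by
  match w with
  | [] => simp [stepF]
  | [a] => simp [stepF]
  | a :: b :: r =>
    simp only [stepF]
    split
    · exact List.Perm.cons _ (List.perm_append_singleton b r)
    · refine (List.Perm.cons b ((List.perm_append_singleton a _).trans
        (List.Perm.cons a (List.reverse_perm r)))).trans (List.Perm.swap a b r)

def SW (c : Bool) (Q : List Ty) : List Ty := some c :: (Q ++ [some (!c)])

lemma step_pass (c : Bool) (Y : List Ty) :
    stepF (SW c (some (!c) :: Y)) = SW c (Y ++ [some (!c)]) := by
  cases c <;> simp [SW, stepF, passB]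

lemma step_tr1 (c : Bool) (Y : List Ty) :
    stepF (SW c (none :: Y)) = none :: some (!c) :: (Y.reverse ++ [some c]) := by
  cases c <;> simp [SW, stepF, passB]

lemma step_tr2 (c : Bool) (Y : List Ty) :
    stepF (none :: some (!c) :: (Y.reverse ++ [some c])) =
      some (!c) :: some c :: (Y ++ [none]) := by
  cases c <;> simp [stepF, passB]

lemma step_tr3 (c : Bool) (Y : List Ty) :
    stepF (some (!c) :: some c :: (Y ++ [none])) = SW (!c) (Y ++ [none]) := by
  cases c <;> simp [SW, stepF, passB]

def tog (X : List Ty) (c : Bool) : Bool := xor c (decide (Odd (X.count none)))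

lemma tog_none (X : List Ty) (c : Bool) : tog (none :: X) c = tog X (!c) := by
  simp only [tog, List.count_cons_self, Nat.odd_add_one]
  by_cases h : Odd (X.count none) <;> cases c <;> simp [h]

lemma tog_some (X : List Ty) (c d : Bool) : tog (some d :: X) c = tog X c := by
  simp [tog]

lemma run_lemma (X : List Ty) : ∀ (Y : List Ty) (c : Bool),
    Collides (SW (tog X c) (Y ++ X)) → Collides (SW c (X ++ Y)) := by
  induction X with
  | nil => intro Y c h; simpa [tog] using h
  | cons x X ih =>
    intro Y c h
    rcases x with _ | d
    · rw [tog_none] at h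
      have := ih (Y ++ [none]) (!c) (by simpa using h)
      apply Collides.of_step
      rw [List.cons_append, step_tr1]
      apply Collides.of_step
      rw [step_tr2]
      apply Collides.of_step
      rw [step_tr3]
      simpa using this
    · rw [tog_some] at h
      by_cases hd : d = c
      · subst hd; exact Collides.of_eq
      · have hd' : d = !c := by cases d <;> cases c <;> simp_all
        subst hd'
        have := ih (Y ++ [some (!c)]) c (by simpa using h)
        apply Collides.of_step
        rw [List.cons_append, step_pass]
        simpa using this

lemma collides_SW (c : Bool) (Q : List Ty) (hodd : Odd (Q.count none))
    (hne : ∃ x ∈ Q, x ≠ none) : Collides (SW c Q) := by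
  obtain ⟨x, hx, hxn⟩ := hne
  obtain ⟨d, rfl⟩ := Option.ne_none_iff_exists'.mp hxn
  obtain ⟨X, Y, rfl⟩ := List.append_of_mem hx
  have key : ∀ c, d = tog X c → Collides (SW c (X ++ some d :: Y)) := by
    intro c h
    apply run_lemma
    rw [← h]
    exact Collides.of_eq
  by_cases h : d = tog X c
  · exact key c h
  · have h2 := key (!c) (by
      revert h; unfold tog
      generalize decide (Odd (List.count none X)) = b
      cases d <;> cases c <;> cases b <;> simp)
    have := run_lemma (X ++ some d :: Y) [] c
    simp only [List.append_nil, List.nil_append] at this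
    apply this
    have h3 : tog (X ++ some d :: Y) c = !c := by
      unfold tog; rw [decide_eq_true hodd]; simp
    rw [h3]; exact h2

lemma normalizeW (w : List Ty) (hw : 4 ≤ w.length) :
    Collides w ∨ ∃ c Q, (SW c Q).Perm w ∧ (Collides (SW c Q) → Collides w) := by
  match w, hw with
  | a :: b :: rest, hw =>
    by_cases hab : a = b
    · subst hab; exact Or.inl Collides.of_eq
    have hrest : rest ≠ [] := by rintro rfl; simp at hw
    rcases a with _ | a
    · rcases b with _ | b
      · exact absurd rfl hab
      have e1 : stepF (none :: some b :: rest) = some b :: (rest.reverse ++ [none]) := by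
        simp [stepF, passB]
      obtain ⟨y, Y, hy⟩ : ∃ y Y, rest.reverse = y :: Y :=
        List.exists_cons_of_ne_nil (by simpa using hrest)
      rw [hy] at e1
      by_cases hyb : y = some b
      · left; apply Collides.of_step; rw [e1, hyb]; exact Collides.of_eq
      rcases y with _ | y
      · left; apply Collides.of_step; rw [e1]; apply Collides.of_step
        simp [stepF, passB]; exact Collides.of_eq
      · have hy' : y = !b := by cases y <;> cases b <;> simp_all
        subst hy'
        right
        have e2 : stepF (some b :: (some (!b) :: Y ++ [none])) = SW b (Y ++ [none]) := by
          cases b <;> simp [stepF, passB, SW]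
        refine ⟨b, Y ++ [none], ?_, ?_⟩
        · rw [← e2, ← e1]; exact (stepF_perm _).trans (stepF_perm _)
        · intro h; apply Collides.of_step; rw [e1]; apply Collides.of_step; rw [e2]; exact h
    · rcases b with _ | b
      · obtain ⟨m, z, rfl⟩ : ∃ m z, rest = m ++ [z] :=
          ⟨_, _, (List.dropLast_append_getLast hrest).symm⟩
        have e1 : stepF (some a :: none :: (m ++ [z])) = none :: z :: (m.reverse ++ [some a]) := by
          simp [stepF, passB]
        rcases z with _ | z
        · left; apply Collides.of_step; rw [e1]; exact Collides.of_eq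
        by_cases hz : z = a
        · subst hz
          left; apply Collides.of_step; rw [e1]; apply Collides.of_step
          simp [stepF, passB]; exact Collides.of_eq
        · have hz' : z = !a := by cases z <;> cases a <;> simp_all
          subst hz'
          right
          exact ⟨a, none :: m, by simp [SW], by simp [SW]⟩
      · right
        have hb : b = !a := by cases b <;> cases a <;> simp_all
        subst hb
        have e1 : stepF (some a :: some (!a) :: rest) = SW a rest := by
          cases a <;> simp [stepF, passB, SW]
        refine ⟨a, rest, by rw [← e1]; exact stepF_perm _, ?_⟩
        intro h; apply Collides.of_step; rw [e1]; exact h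

lemma collides_all (w : List Ty) (hodd : Odd (w.count none)) (hk : w.count none + 3 ≤ w.length) :
    Collides w := by
  have h1 : 1 ≤ w.count none := hodd.pos
  rcases normalizeW w (by omega) with h | ⟨c, Q, hp, h⟩
  · exact h
  · apply h
    have hc := hp.count_eq none
    have hl := hp.length_eq
    simp [SW] at hc hl
    apply collides_SW
    · rw [hc]; exact hodd
    · by_contra hcon
      push Not at hcon
      have : Q.count none = Q.length := List.count_eq_length.mpr (fun b hb => (hcon b hb).symm)
      omega

/-- Good configurations for the queue machine. -/
def Good : Bool → List Ty → Prop
  | _, [] => True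
  | c, none :: Q => Good (!c) Q
  | c, some d :: Q => d = !c ∧ Good c Q

lemma good_append (X : List Ty) : ∀ (Y : List Ty) (c : Bool),
    Good c (X ++ Y) ↔ Good c X ∧ Good (tog X c) Y := by
  induction X with
  | nil => intro Y c; simp [Good, tog]
  | cons x X ih =>
    intro Y c
    rcases x with _ | d
    · simp [Good, ih, tog_none]
    · simp [Good, ih, tog_some, and_assoc]

def QInv (Q : List Ty) (c : Bool) : Prop :=
  Good c Q ∧ (Even (Q.count none) ∨ ∀ x ∈ Q, x = none)

lemma inv_pass (c : Bool) (Y : List Ty) (h : QInv (some (!c) :: Y) c) :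
    QInv (Y ++ [some (!c)]) c := by
  obtain ⟨h1, h2⟩ := h
  rcases h2 with h2 | h2
  · refine ⟨?_, Or.inl (by simpa using h2)⟩
    rw [good_append]
    simp only [Good] at h1 ⊢
    refine ⟨h1.2, ?_, trivial⟩
    have : ¬ Odd (Y.count none) := by simpa using h2
    simp [tog, this]
  · exact absurd (h2 _ (List.mem_cons_self)) (by simp)

lemma good_all_none (Q : List Ty) (h : ∀ x ∈ Q, x = none) : ∀ c, Good c Q := by
  induction Q with
  | nil => intro c; trivial
  | cons x Q ih =>
    intro c
    have := h x List.mem_cons_self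
    subst this
    exact ih (fun y hy => h y (List.mem_cons_of_mem _ hy)) _

lemma inv_tr (c : Bool) (Y : List Ty) (h : QInv (none :: Y) c) :
    QInv (Y ++ [none]) (!c) := by
  obtain ⟨h1, h2⟩ := h
  refine ⟨?_, ?_⟩
  · rw [good_append]; exact ⟨h1, trivial⟩
  · rcases h2 with h2 | h2
    · left; simpa using h2
    · right; intro x hx; apply h2; simp at hx ⊢; tauto

section dyn
variable {V : Type*} [Fintype V]

def ez (D : Xi V) : ZMod (Fintype.card V) := epsZ _ D.2.2
def eI (D : Xi V) : ℤ := if D.2.2 then 1 else -1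
def ps (D : Xi V) : ZMod (Fintype.card V) := if D.2.2 then D.2.1 else D.2.1 + 1
def car (D : Xi V) : V := D.1.symm (ps D)
def tgt (D : Xi V) : V := D.1.symm (ps D + ez D)

lemma swap_eq (D : Xi V) : Equiv.swap D.2.1 (D.2.1 + 1) = Equiv.swap (ps D) (ps D + ez D) := by
  obtain ⟨v, i, e⟩ := D
  cases e
  · simp [ps, ez, epsZ, Equiv.swap_comm]
  · simp [ps, ez, epsZ]

lemma adj_eq (G : SimpleGraph V) (D : Xi V) :
    G.Adj (D.1.symm D.2.1) (D.1.symm (D.2.1 + 1)) ↔ G.Adj (car D) (tgt D) := by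
  obtain ⟨v, i, e⟩ := D
  cases e
  · simp [car, tgt, ps, ez, epsZ, G.adj_comm]
  · simp [car, tgt, ps, ez, epsZ]

lemma one_ne (hn : 3 ≤ Fintype.card V) : (1 : ZMod (Fintype.card V)) ≠ 0 := by
  have : Fact (1 < Fintype.card V) := ⟨by omega⟩
  exact one_ne_zero

lemma ez_ne (hn : 3 ≤ Fintype.card V) (D : Xi V) : ez D ≠ 0 := by
  unfold ez epsZ; split
  · exact one_ne hn
  · simpa using one_ne hn

lemma car_ne_tgt (hn : 3 ≤ Fintype.card V) (D : Xi V) : car D ≠ tgt D := by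
  intro h
  have := D.1.symm.injective h
  exact ez_ne hn D (by simpa using this.symm)

lemma theta_fst (G : SimpleGraph V) (D : Xi V) :
    (theta G D).1 = D.1.trans (Equiv.swap (ps D) (ps D + ez D)) := by
  unfold theta
  rw [swap_eq]
  split <;> rfl

lemma theta_fst_apply (G : SimpleGraph V) (D : Xi V) (a : V) :
    (theta G D).1 a = D.1 (Equiv.swap (car D) (tgt D) a) := by
  rw [theta_fst]
  simp only [Equiv.trans_apply, car, tgt]
  simp only [Equiv.swap_apply_def, Equiv.eq_symm_apply]
  split_ifs <;> simp

lemma theta_adj (G : SimpleGraph V) (D : Xi V) (h : G.Adj (car D) (tgt D)) :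
    (theta G D).2.2 = (!D.2.2) ∧ ps (theta G D) = ps D ∧ ez (theta G D) = - ez D := by
  rw [← adj_eq] at h
  have h2 : (theta G D).2 = (D.2.1 - epsZ _ D.2.2, !D.2.2) := by
    unfold theta; rw [if_pos h]
  obtain ⟨v, i, e⟩ := D
  unfold ps ez
  rw [h2]
  cases e <;> simp [epsZ]

lemma theta_nadj (G : SimpleGraph V) (D : Xi V) (h : ¬ G.Adj (car D) (tgt D)) :
    (theta G D).2.2 = D.2.2 ∧ ps (theta G D) = ps D + ez D ∧ ez (theta G D) = ez D := by
  rw [← adj_eq] at h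
  have h2 : (theta G D).2 = (D.2.1 + epsZ _ D.2.2, D.2.2) := by
    unfold theta; rw [if_neg h]
  obtain ⟨v, i, e⟩ := D
  unfold ps ez
  rw [h2]
  cases e <;> simp [epsZ]

lemma disp_eq (hn : 3 ≤ Fintype.card V) (D : Xi V) (a : V) :
    disp D a = if a = car D then eI D else if a = tgt D then - eI D else 0 := by
  have h1 := one_ne hn
  obtain ⟨v, i, e⟩ := D
  have ha : ∀ x, a = v.symm x ↔ v a = x := fun x => Equiv.eq_symm_apply v
  cases e
  · simp only [disp, car, tgt, ps, ez, epsZ, eI, ha]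
    by_cases h : v a = i
    · simp [h, h1]
    · simp [h]
  · simp only [disp, car, tgt, ps, ez, epsZ, eI, ha]
    simp

/-- word of types read from the carried replica -/
def wf (τ : V → Ty) (D : Xi V) (j : ℕ) : Ty := τ (D.1.symm (ps D + j * ez D))

def word (τ : V → Ty) (D : Xi V) : List Ty :=
  List.ofFn (fun j : Fin (Fintype.card V) => wf τ D j)

lemma mul_ez_ne (_hn : 3 ≤ Fintype.card V) (D : Xi V) {i j : ℕ} (hi : i < Fintype.card V)
    (hj : j < Fintype.card V) (hij : i ≠ j) :
    ps D + (i : ZMod (Fintype.card V)) * ez D ≠ ps D + j * ez D := by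
  intro h
  have h := add_left_cancel h
  have h2 : (i : ZMod (Fintype.card V)) = j := by
    unfold ez epsZ at h
    split at h
    · simpa using h
    · simpa using h
  rw [ZMod.natCast_eq_natCast_iff'] at h2
  rw [Nat.mod_eq_of_lt hi, Nat.mod_eq_of_lt hj] at h2
  exact hij h2

lemma theta_symm (G : SimpleGraph V) (D : Xi V) (x) :
    (theta G D).1.symm x = D.1.symm (Equiv.swap (ps D) (ps D + ez D) x) := by
  rw [theta_fst]; simp

def Compat (G : SimpleGraph V) (τ : V → Ty) : Prop :=
  ∀ a b, a ≠ b → (G.Adj a b ↔ passB (τ a) (τ b) = false)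

lemma wf_zero (τ : V → Ty) (D : Xi V) : wf τ D 0 = τ (car D) := by simp [wf, car]
lemma wf_one (τ : V → Ty) (D : Xi V) : wf τ D 1 = τ (tgt D) := by simp [wf, tgt]

lemma word_theta (G : SimpleGraph V) (τ : V → Ty) (hG : Compat G τ) (hn : 3 ≤ Fintype.card V)
    (D : Xi V) : word τ (theta G D) = stepF (word τ D) := by
  obtain ⟨m, hm⟩ : ∃ m, Fintype.card V = m + 2 := ⟨Fintype.card V - 2, by omega⟩
  have hw : word τ D = wf τ D 0 :: wf τ D 1 :: List.ofFn (fun j : Fin m => wf τ D (j + 2)) := by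
    unfold word
    apply List.ext_getElem
    · simp [hm]
    · intro i h1 h2
      rcases i with _ | _ | i <;> simp
  have hA := hG _ _ (car_ne_tgt hn D)
  have s0 : ∀ x : ZMod (Fintype.card V), x = ps D →
      Equiv.swap (ps D) (ps D + ez D) x = ps D + ((1:ℕ) : ZMod (Fintype.card V)) * ez D := by
    rintro x rfl; simp
  have s1 : ∀ x : ZMod (Fintype.card V), x = ps D + ez D →
      Equiv.swap (ps D) (ps D + ez D) x = ps D + ((0:ℕ) : ZMod (Fintype.card V)) * ez D := by
    rintro x rfl; simp
  have s2 : ∀ (x : ZMod (Fintype.card V)) (j : ℕ), 2 ≤ j → j < Fintype.card V →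
      x = ps D + (j : ZMod (Fintype.card V)) * ez D →
      Equiv.swap (ps D) (ps D + ez D) x = ps D + (j : ZMod (Fintype.card V)) * ez D := by
    rintro x j h2 hj rfl
    apply Equiv.swap_apply_of_ne_of_ne
    · have := mul_ez_ne hn D hj (show 0 < Fintype.card V by omega) (by omega)
      simpa using this
    · have := mul_ez_ne hn D hj (show 1 < Fintype.card V by omega) (by omega)
      simpa using this
  have hcast : ((m : ZMod (Fintype.card V)) + 2) = 0 := by
    have : ((Fintype.card V : ℕ) : ZMod (Fintype.card V)) = 0 := ZMod.natCast_self _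
    rw [show ((m : ZMod (Fintype.card V)) + 2) = ((m + 2 : ℕ) : ZMod (Fintype.card V)) by
      push_cast; rfl, ← hm, this]
  rw [hw]
  by_cases hp : passB (wf τ D 0) (wf τ D 1)
  · have hna : ¬ G.Adj (car D) (tgt D) := by
      rw [hA, ← wf_zero τ D, ← wf_one τ D, hp]; simp
    obtain ⟨_, hps, hez⟩ := theta_nadj G D hna
    simp only [stepF, hp, if_true]
    apply List.ext_getElem
    · simp [word, hm]
    · intro i h1 h2
      have hi : i < m + 2 := by rw [word, List.length_ofFn, hm] at h1; exact h1
      simp only [word, List.getElem_ofFn]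
      unfold wf
      rw [theta_symm, hps, hez]
      rcases i with _ | i
      · rw [s1 _ (by simp)]; simp
      · by_cases him : i < m
        · rw [s2 _ (i + 2) (by omega) (by omega) (by push_cast; ring)]
          simp [him]
        · have : i = m := by omega
          subst this
          rw [s0 _ (by push_cast; linear_combination (ez D) * hcast)]
          simp
  · have hna : G.Adj (car D) (tgt D) := by
      rw [hA, ← wf_zero τ D, ← wf_one τ D]; simpa using hp
    obtain ⟨_, hps, hez⟩ := theta_adj G D hna
    simp only [stepF, hp]
    apply List.ext_getElem
    · simp [word, hm]
    · intro i h1 h2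
      have hi : i < m + 2 := by rw [word, List.length_ofFn, hm] at h1; exact h1
      simp only [word, List.getElem_ofFn]
      unfold wf
      rw [theta_symm, hps, hez]
      rcases i with _ | i
      · rw [s0 _ (by simp)]; simp
      · by_cases him : i < m
        · rw [s2 _ (m - 1 - i + 2) (by omega) (by omega) (by
            have hc : ((m - 1 - i + 2 : ℕ) : ZMod (Fintype.card V)) + (i + 1) = m + 2 := by
              have hc0 : (m - 1 - i + 2) + (i + 1) = m + 2 := by omega
              exact_mod_cast congrArg (Nat.cast : ℕ → ZMod (Fintype.card V)) hc0
            push_cast at hc ⊢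
            linear_combination (-ez D) * hcast - (ez D) * hc)]
          simp [him]
        · have : i = m := by omega
          subst this
          rw [s1 _ (by push_cast; linear_combination (-ez D) * hcast)]
          simp

lemma word_iter (G : SimpleGraph V) (τ : V → Ty) (hG : Compat G τ) (hn : 3 ≤ Fintype.card V)
    (D : Xi V) (t : ℕ) : word τ ((theta G)^[t] D) = stepF^[t] (word τ D) := by
  induction t with
  | zero => rfl
  | succ t ih => rw [Function.iterate_succ_apply', Function.iterate_succ_apply',
      word_theta G τ hG hn, ih]

lemma word_cons (τ : V → Ty) (hn : 3 ≤ Fintype.card V) (D : Xi V) :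
    ∃ r, word τ D = τ (car D) :: τ (tgt D) :: r := by
  obtain ⟨m, hm⟩ : ∃ m, Fintype.card V = m + 2 := ⟨Fintype.card V - 2, by omega⟩
  refine ⟨List.ofFn (fun j : Fin m => wf τ D (j + 2)), ?_⟩
  rw [← wf_zero τ D, ← wf_one τ D]
  unfold word
  apply List.ext_getElem
  · simp [hm]
  · intro i h1 h2
    rcases i with _ | _ | i <;> simp

lemma word_length (τ : V → Ty) (D : Xi V) : (word τ D).length = Fintype.card V := by
  simp [word]

lemma ps_bij (hn : 3 ≤ Fintype.card V) (D : Xi V) : Function.Bijective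
    (fun j : Fin (Fintype.card V) => D.1.symm (ps D + (j : ℕ) * ez D)) := by
  rw [Fintype.bijective_iff_injective_and_card]
  refine ⟨?_, by simp⟩
  intro i j h
  have h := D.1.symm.injective h
  by_contra hij
  exact mul_ez_ne hn D i.2 j.2 (fun h => hij (Fin.ext h)) h

lemma word_count (τ : V → Ty) (hn : 3 ≤ Fintype.card V) (D : Xi V) (x : Ty) :
    (word τ D).count x = (Finset.univ.filter (fun a => τ a = x)).card := by
  rw [word, List.count, List.countP_eq_length_filter]
  have h1 : ∀ (N : ℕ) (f : Fin N → Ty), ((List.ofFn f).filter (fun y => y == x)).length =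
      (Finset.univ.filter (fun j => f j = x)).card := by
    intro N f
    rw [← List.countP_eq_length_filter, List.ofFn_eq_map, List.countP_map]
    rw [List.countP_eq_length_filter]
    rw [← List.toFinset_card_of_nodup ((List.nodup_finRange N).filter _)]
    congr 1
    ext j; simp
  rw [h1]
  let e := Equiv.ofBijective _ (ps_bij hn D)
  apply Finset.card_equiv e
  intro i
  rw [Finset.mem_filter, Finset.mem_filter]
  simp [e, wf]

lemma exists_coll (G : SimpleGraph V) (τ : V → Ty) (hG : Compat G τ)
    (hodd : Odd (Finset.univ.filter (fun a => τ a = none)).card)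
    (hk : (Finset.univ.filter (fun a => τ a = none)).card + 3 ≤ Fintype.card V) (D : Xi V) :
    ∃ t, τ (car ((theta G)^[t] D)) = τ (tgt ((theta G)^[t] D)) := by
  have hn : 3 ≤ Fintype.card V := by omega
  obtain ⟨t, ht⟩ := collides_all (word τ D) (by rw [word_count τ hn]; exact hodd)
    (by rw [word_count τ hn, word_length]; exact hk)
  refine ⟨t, ?_⟩
  rw [← word_iter G τ hG hn] at ht
  obtain ⟨r, hr⟩ := word_cons τ hn ((theta G)^[t] D)
  rw [hr] at ht
  exact ht
end dyn

section dyn2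
variable {V : Type*} [Fintype V]

def rv (D : Xi V) : Xi V := (D.1, D.2.1 - ez D, !D.2.2)

lemma ext_ps {D E : Xi V} (h1 : D.1 = E.1) (h2 : ps D = ps E) (h3 : D.2.2 = E.2.2) : D = E := by
  obtain ⟨v, i, e⟩ := D
  obtain ⟨v', i', e'⟩ := E
  simp only at h1 h3
  subst h1 h3
  cases e <;> simp [ps] at h2 <;> simp [h2]

lemma rv_fst (D : Xi V) : (rv D).1 = D.1 := rfl
lemma rv_snd (D : Xi V) : (rv D).2.2 = !D.2.2 := rfl
lemma rv_ps (D : Xi V) : ps (rv D) = ps D := by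
  obtain ⟨v, i, e⟩ := D
  cases e <;> simp [ps, rv, ez, epsZ]
lemma rv_ez (D : Xi V) : ez (rv D) = - ez D := by
  obtain ⟨v, i, e⟩ := D
  cases e <;> simp [rv, ez, epsZ]
lemma rv_rv (D : Xi V) : rv (rv D) = D :=
  ext_ps rfl (by rw [rv_ps, rv_ps]) (by simp [rv_snd])

lemma theta_rv_theta (G : SimpleGraph V) (D : Xi V) :
    theta G (rv (theta G D)) = rv D ∧ (rv (theta G D)).2.1 = D.2.1 := by
  have hi : (rv (theta G D)).2.1 = D.2.1 := by
    unfold rv ez theta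
    obtain ⟨v, i, e⟩ := D
    split <;> cases e <;> simp [epsZ]
  refine ⟨?_, hi⟩
  have hcar : ∀ x, (rv (theta G D)).1.symm x = D.1.symm (Equiv.swap D.2.1 (D.2.1 + 1) x) := by
    intro x; rw [rv_fst, theta_symm, swap_eq]
  have hadj : G.Adj ((rv (theta G D)).1.symm (rv (theta G D)).2.1)
      ((rv (theta G D)).1.symm ((rv (theta G D)).2.1 + 1)) ↔
      G.Adj (D.1.symm D.2.1) (D.1.symm (D.2.1 + 1)) := by
    rw [hi, hcar, hcar]; simp [G.adj_comm]
  have hv : (rv (theta G D)).1.trans (Equiv.swap D.2.1 (D.2.1 + 1)) = D.1 := by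
    ext a
    rw [rv_fst, theta_fst, swap_eq]; simp
  by_cases h : G.Adj (D.1.symm D.2.1) (D.1.symm (D.2.1 + 1))
  · have he : (rv (theta G D)).2.2 = D.2.2 := by
      rw [rv_snd, theta, if_pos h]; simp
    rw [theta, if_pos (hadj.mpr h), hi, he, hv]
    rfl
  · have he : (rv (theta G D)).2.2 = !D.2.2 := by
      rw [rv_snd, theta, if_neg h]
    rw [theta, if_neg (by rwa [hadj]), hi, he, hv]
    obtain ⟨v, i, e⟩ := D
    cases e <;> simp [rv, ez, epsZ, sub_eq_add_neg]

lemma theta_inj (G : SimpleGraph V) : Function.Injective (theta G) := by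
  intro D E h
  have h1 := (theta_rv_theta G D).1
  rw [h, (theta_rv_theta G E).1] at h1
  rw [← rv_rv D, ← rv_rv E, h1]

lemma disp_rv_theta (hn : 3 ≤ Fintype.card V) (G : SimpleGraph V) (D : Xi V) (a : V) :
    disp (rv (theta G D)) a = - disp D a := by
  have h1 := one_ne hn
  unfold disp
  rw [(theta_rv_theta G D).2, rv_fst, theta_fst, ← swap_eq]
  simp only [Equiv.trans_apply]
  by_cases ha : D.1 a = D.2.1
  · simp [ha, h1]
  · by_cases hb : D.1 a = D.2.1 + 1
    · simp [hb, h1]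
    · simp only [Equiv.swap_apply_of_ne_of_ne ha hb]; simp [ha, hb]

/-- relabelling -/
def act (π : Equiv.Perm V) (D : Xi V) : Xi V := (π.symm.trans D.1, D.2)

lemma act_mul (π σ : Equiv.Perm V) (D : Xi V) : act (π * σ) D = act π (act σ D) := rfl

lemma act_one (D : Xi V) : act 1 D = D := rfl

lemma rv_act (π : Equiv.Perm V) (D : Xi V) : rv (act π D) = act π (rv D) := rfl

lemma disp_act (π : Equiv.Perm V) (D : Xi V) (a : V) : disp (act π D) a = disp D (π⁻¹ a) := rfl

lemma ps_act (π : Equiv.Perm V) (D : Xi V) : ps (act π D) = ps D := rfl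

lemma theta_act (G : SimpleGraph V) (π : Equiv.Perm V)
    (hπ : ∀ a b, G.Adj (π a) (π b) ↔ G.Adj a b) (D : Xi V) :
    theta G (act π D) = act π (theta G D) := by
  unfold theta
  have : G.Adj ((act π D).1.symm (act π D).2.1) ((act π D).1.symm ((act π D).2.1 + 1)) ↔
      G.Adj (D.1.symm D.2.1) (D.1.symm (D.2.1 + 1)) := by
    simp [act, hπ]
  by_cases h : G.Adj (D.1.symm D.2.1) (D.1.symm (D.2.1 + 1))
  · rw [if_pos h, if_pos (this.mpr h)]; rfl
  · rw [if_neg h, if_neg (by rwa [this])]; rfl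

lemma iter_act (G : SimpleGraph V) (π : Equiv.Perm V)
    (hπ : ∀ a b, G.Adj (π a) (π b) ↔ G.Adj a b) (D : Xi V) (t : ℕ) :
    (theta G)^[t] (act π D) = act π ((theta G)^[t] D) := by
  induction t with
  | zero => rfl
  | succ t ih => rw [Function.iterate_succ_apply', Function.iterate_succ_apply', ih,
      theta_act G π hπ]

lemma compat_swap {G : SimpleGraph V} {τ : V → Ty} (hG : Compat G τ) {p q : V} (h : τ p = τ q) :
    ∀ a b, G.Adj (Equiv.swap p q a) (Equiv.swap p q b) ↔ G.Adj a b := by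
  have ht : ∀ a, τ (Equiv.swap p q a) = τ a := by
    intro a
    rw [Equiv.swap_apply_def]
    split_ifs with h1 h2 <;> simp_all
  intro a b
  by_cases hab : a = b
  · subst hab; simp
  · rw [hG _ _ hab, hG _ _ (fun h => hab ((Equiv.swap p q).injective h)), ht, ht]

lemma passB_self (x : Ty) : passB x x = false := by
  rcases x with _ | x <;> simp [passB]

/-- a same-type collision is a reversal up to relabelling -/
lemma theta_coll (hn : 3 ≤ Fintype.card V) {G : SimpleGraph V} {τ : V → Ty} (hG : Compat G τ)
    (D : Xi V) (h : τ (car D) = τ (tgt D)) :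
    theta G D = act (Equiv.swap (car D) (tgt D)) (rv D) := by
  have hA : G.Adj (car D) (tgt D) := by
    rw [hG _ _ (car_ne_tgt hn D), h, passB_self]
  obtain ⟨h1, h2, h3⟩ := theta_adj G D hA
  apply ext_ps
  · ext a
    rw [theta_fst_apply]
    simp [act, rv_fst]
  · rw [h2, ps_act, rv_ps]
  · rw [h1]; rfl

/-- accumulated displacement -/
noncomputable def dsum (G : SimpleGraph V) (D : Xi V) (t : ℕ) (a : V) : ℤ :=
  ∑ k ∈ Finset.range t, disp ((theta G)^[k] D) a

lemma dsum_succ (G : SimpleGraph V) (D : Xi V) (t : ℕ) (a : V) :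
    dsum G D (t + 1) a = dsum G D t a + disp ((theta G)^[t] D) a := Finset.sum_range_succ _ _

lemma dsum_add (G : SimpleGraph V) (D : Xi V) (s t : ℕ) (a : V) :
    dsum G D (s + t) a = dsum G D s a + dsum G ((theta G)^[s] D) t a := by
  unfold dsum
  rw [Finset.sum_range_add]
  congr 1
  apply Finset.sum_congr rfl
  intro k _
  rw [← Function.iterate_add_apply, add_comm]

lemma dsum_mul (G : SimpleGraph V) (D : Xi V) (P m : ℕ) (a : V) (h : (theta G)^[P] D = D) :
    dsum G D (P * m) a = m * dsum G D P a ∧ (theta G)^[P * m] D = D := by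
  induction m with
  | zero => simp [dsum]
  | succ m ih =>
    rw [Nat.mul_succ]
    constructor
    · rw [dsum_add, ih.1, ih.2]; push_cast; ring
    · rw [add_comm, Function.iterate_add_apply, ih.2, h]

/-- zero winding from a return of a later state with zero displacement -/
lemma wind_zero (G : SimpleGraph V) (D : Xi V) (s M : ℕ) (hM : 0 < M) (a : V)
    (h1 : (theta G)^[M] ((theta G)^[s] D) = (theta G)^[s] D)
    (h2 : dsum G ((theta G)^[s] D) M a = 0) : windSum G D a = 0 := by
  have h3 : (theta G)^[M] D = D := by
    rw [← Function.iterate_add_apply, add_comm, Function.iterate_add_apply] at h1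
    exact (theta_inj G).iterate s h1
  have h4 : dsum G D M a = 0 := by
    have e1 := dsum_add G D s M a
    have e2 := dsum_add G D M s a
    rw [h3, add_comm M s] at e2
    linarith
  have hdvd := Function.IsPeriodicPt.minimalPeriod_dvd (f := theta G) (x := D) (n := M) h3
  obtain ⟨m, hm⟩ := hdvd
  have := (dsum_mul G D (Function.minimalPeriod (theta G) D) m a
    (Function.iterate_minimalPeriod)).1
  rw [← hm, h4] at this
  have hm0 : (m : ℤ) ≠ 0 := by
    rintro h; have : m = 0 := by exact_mod_cast h
    subst this; omega
  rcases mul_eq_zero.mp this.symm with h | h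
  · exact absurd h hm0
  · exact h

/-- Telescoping. -/
lemma tele (hn : 3 ≤ Fintype.card V) {G : SimpleGraph V} {τ : V → Ty} (hG : Compat G τ)
    (D E : Xi V) (s h : ℕ) (hs : (theta G)^[s] D = E)
    (hE : τ (car E) = τ (tgt E))
    (hB : τ (car ((theta G)^[h] (theta G E))) = τ (tgt ((theta G)^[h] (theta G E))))
    (y : V → ℤ) (hy0 : y (car E) - y (tgt E) = eI E)
    (hyh : ∀ p q, p = car ((theta G)^[h] (theta G E)) → q = tgt ((theta G)^[h] (theta G E)) →
      (y q + dsum G (theta G E) h q) - (y p + dsum G (theta G E) h p) =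
        eI ((theta G)^[h] (theta G E))) (a : V) :
    windSum G D a = 0 := by
  set D0 := theta G E with hD0
  set p := car ((theta G)^[h] D0) with hp
  set q := tgt ((theta G)^[h] D0) with hq
  set σ := Equiv.swap p q with hσ
  set σ' := Equiv.swap (car E) (tgt E) with hσ'
  have hpq : p ≠ q := car_ne_tgt hn _
  have hpq' : car E ≠ tgt E := car_ne_tgt hn _
  have aσ := compat_swap hG hB
  have aσ' := compat_swap hG hE
  have hinv : ∀ x, σ⁻¹ x = σ x := fun x => by rw [hσ, Equiv.swap_inv]
  have hss : ∀ x, σ (σ x) = x := fun x => by rw [hσ]; simp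
  -- states
  have st : ∀ j ≤ h, (theta G)^[h + 1 + j] D0 = act σ (rv ((theta G)^[h - j] D0)) := by
    intro j
    induction j with
    | zero =>
      intro _
      rw [add_zero, Function.iterate_succ_apply', theta_coll hn hG _ hB]
      rfl
    | succ j ih =>
      intro hj
      rw [← add_assoc, Function.iterate_succ_apply', ih (by omega), theta_act G _ aσ]
      obtain ⟨m, hm⟩ : ∃ m, h - j = m + 1 := ⟨h - j - 1, by omega⟩
      rw [hm, Function.iterate_succ_apply', (theta_rv_theta G _).1]
      rw [show h - (j + 1) = m by omega]
  have stN : (theta G)^[2 * h + 2] D0 = act (σ * σ') D0 := by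
    have := st h le_rfl
    rw [show 2 * h + 2 = (h + 1 + h) + 1 by omega, Function.iterate_succ_apply', this,
      theta_act G _ aσ, Nat.sub_self, Function.iterate_zero, id_eq, hD0, (theta_rv_theta G E).1,
      theta_coll hn hG _ hE, act_mul, ← act_mul σ' σ', hσ', Equiv.swap_mul_self, act_one]
  -- displacement
  have dp : ∀ j ≤ h, ∀ a, y a + dsum G D0 (h + 1 + j) a = y (σ a) + dsum G D0 (h - j) (σ a) := by
    intro j
    induction j with
    | zero =>
      intro _ a
      have hyh := hyh p q rfl rfl
      rw [add_zero, dsum_succ, disp_eq hn, ← hp, ← hq, Nat.sub_zero]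
      by_cases h1 : a = p
      · rw [if_pos h1, h1, hσ, Equiv.swap_apply_left]; linarith
      · by_cases h2 : a = q
        · rw [if_neg h1, if_pos h2, h2, hσ, Equiv.swap_apply_right]; linarith
        · rw [if_neg h1, if_neg h2, hσ, Equiv.swap_apply_of_ne_of_ne h1 h2]; ring
    | succ j ih =>
      intro hj a
      have ih := ih (by omega) a
      rw [← add_assoc, dsum_succ, st j (by omega), disp_act, hinv]
      obtain ⟨m, hm⟩ : ∃ m, h - j = m + 1 := ⟨h - j - 1, by omega⟩
      rw [hm, Function.iterate_succ_apply', disp_rv_theta hn]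
      rw [hm, dsum_succ] at ih
      rw [show h - (j + 1) = m by omega]
      linarith
  have dpN : ∀ a, dsum G D0 (2 * h + 2) a = y ((σ * σ')⁻¹ a) - y a := by
    intro a
    have k1 := dp h le_rfl a
    rw [Nat.sub_self] at k1
    have h0 : dsum G D0 0 (σ a) = 0 := by simp [dsum]
    rw [h0] at k1
    rw [show 2 * h + 2 = (h + 1 + h) + 1 by omega, dsum_succ, st h le_rfl, disp_act, hinv,
      Nat.sub_self, Function.iterate_zero, id_eq, hD0, disp_rv_theta hn, ← hD0]
    have h2 : (σ * σ')⁻¹ a = σ' (σ a) := by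
      rw [mul_inv_rev, Equiv.Perm.mul_apply, hinv, hσ', Equiv.swap_inv]
    rw [h2]
    generalize σ a = b at *
    rw [disp_eq hn]
    by_cases h1 : b = car E
    · rw [if_pos h1, h1, hσ', Equiv.swap_apply_left]; rw [h1] at k1; linarith
    · by_cases h2 : b = tgt E
      · rw [if_neg h1, if_pos h2, h2, hσ', Equiv.swap_apply_right]; rw [h2] at k1; linarith
      · rw [if_neg h1, if_neg h2, hσ', Equiv.swap_apply_of_ne_of_ne h1 h2]; linarith
  have ag : ∀ a b, G.Adj ((σ * σ') a) ((σ * σ') b) ↔ G.Adj a b := by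
    intro a b
    rw [Equiv.Perm.mul_apply, Equiv.Perm.mul_apply, aσ, aσ']
  have fin : ∀ m, (theta G)^[(2 * h + 2) * m] D0 = act ((σ * σ') ^ m) D0 ∧
      ∀ a, dsum G D0 ((2 * h + 2) * m) a = y (((σ * σ') ^ m)⁻¹ a) - y a := by
    intro m
    induction m with
    | zero => simp [act_one, dsum]
    | succ m ih =>
      constructor
      · rw [Nat.mul_succ, Function.iterate_add_apply, stN, iter_act G _ ag, ih.1, ← act_mul,
          pow_succ']
      · intro a
        rw [Nat.mul_succ, add_comm, dsum_add, stN, dpN]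
        have : dsum G (act (σ * σ') D0) ((2 * h + 2) * m) a =
            dsum G D0 ((2 * h + 2) * m) ((σ * σ')⁻¹ a) := by
          unfold dsum
          apply Finset.sum_congr rfl
          intro k _
          rw [iter_act G _ ag, disp_act]
        have e : ((σ * σ') ^ (m + 1))⁻¹ a = ((σ * σ') ^ m)⁻¹ ((σ * σ')⁻¹ a) := by
          rw [pow_succ']
          generalize σ * σ' = g
          rw [mul_inv_rev, Equiv.Perm.mul_apply]
        rw [this, ih.2, e]
        ring
  obtain ⟨m, hm0, hm⟩ : ∃ m, 0 < m ∧ (σ * σ') ^ m = 1 :=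
    ⟨orderOf (σ * σ'), orderOf_pos _, pow_orderOf_eq_one _⟩
  have hsD : (theta G)^[s + 1] D = D0 := by rw [Function.iterate_succ_apply', hs]
  apply wind_zero G D (s + 1) ((2 * h + 2) * m) (by positivity) a
  · rw [hsD, (fin m).1, hm, act_one]
  · rw [hsD, (fin m).2, hm]; simp

end dyn2

section dyn3
variable {V : Type*} [Fintype V]

lemma val_of (hn : 3 ≤ Fintype.card V) (u : ZMod (Fintype.card V)) (y : ℤ)
    (h : (y : ZMod (Fintype.card V)) = u) (h0 : 0 ≤ y) (h1 : y < Fintype.card V) :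
    (u.val : ℤ) = y := by
  have : NeZero (Fintype.card V) := ⟨by omega⟩
  rw [← h, ZMod.val_intCast, Int.emod_eq_of_lt h0 h1]

def rr (D : Xi V) (z c : V) : ℤ := ((D.1 z - D.1 c).val : ℤ)

noncomputable def crs (D : Xi V) (z c : V) : ℤ :=
  if z = car D ∧ c = tgt D then - eI D else if z = tgt D ∧ c = car D then eI D else 0

lemma rr_bd (hn : 3 ≤ Fintype.card V) (D : Xi V) {z c : V} (h : z ≠ c) :
    1 ≤ rr D z c ∧ rr D z c < Fintype.card V := by
  have : NeZero (Fintype.card V) := ⟨by omega⟩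
  have h1 := ZMod.val_lt (D.1 z - D.1 c)
  have h2 : (D.1 z - D.1 c).val ≠ 0 := by
    rw [Ne, ZMod.val_eq_zero, sub_eq_zero]
    exact fun h' => h (D.1.injective h')
  unfold rr
  omega

lemma rr_cast (hn : 3 ≤ Fintype.card V) (D : Xi V) (z c : V) :
    ((rr D z c : ℤ) : ZMod (Fintype.card V)) = D.1 z - D.1 c := by
  have : NeZero (Fintype.card V) := ⟨by omega⟩
  unfold rr; simp

lemma eI_cast (D : Xi V) : ((eI D : ℤ) : ZMod (Fintype.card V)) = ez D := by
  unfold eI ez epsZ; split <;> simp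

lemma eI_cases (D : Xi V) : eI D = 1 ∨ eI D = -1 := by
  unfold eI; split <;> simp

lemma app_car (D : Xi V) : D.1 (car D) = ps D := by simp [car]
lemma app_tgt (D : Xi V) : D.1 (tgt D) = ps D + ez D := by simp [tgt]

lemma theta_disp (hn : 3 ≤ Fintype.card V) (G : SimpleGraph V) (D : Xi V) (a : V) :
    (theta G D).1 a = D.1 a + ((disp D a : ℤ) : ZMod (Fintype.card V)) := by
  rw [theta_fst_apply, disp_eq hn]
  by_cases h1 : a = car D
  · subst h1; rw [if_pos rfl, Equiv.swap_apply_left, app_car, app_tgt, eI_cast]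
  · by_cases h2 : a = tgt D
    · subst h2; rw [if_neg h1, if_pos rfl, Equiv.swap_apply_right, app_car, app_tgt,
        Int.cast_neg, eI_cast]; ring
    · rw [if_neg h1, if_neg h2, Equiv.swap_apply_of_ne_of_ne h1 h2]; simp

lemma rr_step (hn : 3 ≤ Fintype.card V) (G : SimpleGraph V) (D : Xi V) {z c : V} (h : z ≠ c) :
    rr (theta G D) z c = rr D z c + disp D z - disp D c + Fintype.card V * crs D z c := by
  obtain ⟨b1, b2⟩ := rr_bd hn D h
  obtain ⟨b3, b4⟩ := rr_bd hn (theta G D) h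
  have hc := rr_cast hn D z c
  have hct := car_ne_tgt hn D
  have e0 : (((rr D z c + disp D z - disp D c + Fintype.card V * crs D z c : ℤ)) :
      ZMod (Fintype.card V)) = (theta G D).1 z - (theta G D).1 c := by
    push_cast
    rw [hc, theta_disp hn, theta_disp hn, ZMod.natCast_self]; ring
  have hne : rr D z c + disp D z - disp D c + Fintype.card V * crs D z c ≠ Fintype.card V := by
    intro h'
    rw [h'] at e0
    simp only [Int.cast_natCast, ZMod.natCast_self] at e0
    exact h ((theta G D).1.injective (sub_eq_zero.mp e0.symm))
  have key : 0 ≤ rr D z c + disp D z - disp D c + Fintype.card V * crs D z c ∧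
      rr D z c + disp D z - disp D c + Fintype.card V * crs D z c ≤ Fintype.card V := by
    rw [disp_eq hn, disp_eq hn]
    unfold crs
    by_cases z1 : z = car D
    · have c1 : c ≠ car D := fun h' => h (z1.trans h'.symm)
      by_cases c2 : c = tgt D
      · have hx : D.1 z - D.1 c = - ez D := by rw [z1, c2, app_car, app_tgt]; ring
        subst z1 c2
        rcases eI_cases D with he | he
        · have : rr D (car D) (tgt D) = Fintype.card V - 1 := by
            apply val_of hn _ _ _ (by omega) (by omega)
            rw [hx, ← eI_cast, he]; simp
          simp [he, this, hct.symm]; omega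
        · have : rr D (car D) (tgt D) = 1 := by
            apply val_of hn _ _ _ (by omega) (by omega)
            rw [hx, ← eI_cast, he]; simp
          simp [he, this, hct.symm]; omega
      · have z2 : z ≠ tgt D := by rw [z1]; exact hct
        simp only [z1, c1, c2, hct, if_true, if_false, and_false, false_and]
        subst z1
        rcases eI_cases D with he | he <;> rw [he] <;> omega
    · by_cases z2 : z = tgt D
      · have c2 : c ≠ tgt D := fun h' => h (z2.trans h'.symm)
        by_cases c1 : c = car D
        · have hx : D.1 z - D.1 c = ez D := by rw [z2, c1, app_car, app_tgt]; ring
          subst z2 c1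
          rcases eI_cases D with he | he
          · have : rr D (tgt D) (car D) = 1 := by
              apply val_of hn _ _ _ (by omega) (by omega)
              rw [hx, ← eI_cast, he]
            simp [he, this, hct, hct.symm]
            omega
          · have : rr D (tgt D) (car D) = Fintype.card V - 1 := by
              apply val_of hn _ _ _ (by omega) (by omega)
              rw [hx, ← eI_cast, he]; simp
            simp [he, this, hct, hct.symm]
            omega
        · subst z2
          simp only [z1, c1, c2, if_true, if_false, and_false, false_and]
          rcases eI_cases D with he | he <;> rw [he] <;> omega
      · simp only [z1, z2, if_false, false_and]
        rcases eI_cases D with he | he <;> rw [he] <;> split_ifs <;> omega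
  exact val_of hn _ _ e0 key.1 (lt_of_le_of_ne key.2 hne)

noncomputable def csum (G : SimpleGraph V) (D : Xi V) (t : ℕ) (z c : V) : ℤ :=
  ∑ k ∈ Finset.range t, crs ((theta G)^[k] D) z c

lemma rr_iter (hn : 3 ≤ Fintype.card V) (G : SimpleGraph V) (D : Xi V) {z c : V} (h : z ≠ c)
    (t : ℕ) : rr ((theta G)^[t] D) z c = rr D z c + dsum G D t z - dsum G D t c +
      Fintype.card V * csum G D t z c := by
  induction t with
  | zero => simp [dsum, csum]
  | succ t ih =>
    rw [Function.iterate_succ_apply', rr_step hn G _ h, ih, dsum_succ, dsum_succ]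
    unfold csum
    rw [Finset.sum_range_succ]
    ring

lemma csum_zero (G : SimpleGraph V) (τ : V → Ty) (D : Xi V) (t : ℕ)
    (hno : ∀ k < t, τ (car ((theta G)^[k] D)) ≠ τ (tgt ((theta G)^[k] D))) {z c : V}
    (h : τ z = τ c) : csum G D t z c = 0 := by
  apply Finset.sum_eq_zero
  intro k hk
  have := hno k (Finset.mem_range.mp hk)
  unfold crs
  rw [if_neg, if_neg]
  · rintro ⟨rfl, rfl⟩; exact this h.symm
  · rintro ⟨rfl, rfl⟩; exact this h

lemma odd_cross (hn : 3 ≤ Fintype.card V) (G : SimpleGraph V) (D : Xi V) (t : ℕ) {x y z : V}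
    (hxy : x ≠ y) (hzx : z ≠ x) (hzy : z ≠ y) (h0 : D.1 x - D.1 y = 1)
    (h1 : ((theta G)^[t] D).1 x - ((theta G)^[t] D).1 y = -1) (hc : csum G D t x y = 0) :
    csum G D t z y = csum G D t z x - 1 := by
  have r0 : rr D x y = 1 := by
    apply val_of hn _ _ _ (by omega) (by omega)
    rw [h0]; simp
  have r1 : rr ((theta G)^[t] D) x y = Fintype.card V - 1 := by
    apply val_of hn _ _ _ (by omega) (by omega)
    rw [h1]; simp
  have i1 := rr_iter hn G D hxy t
  have i2 := rr_iter hn G D hzx t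
  have i3 := rr_iter hn G D hzy t
  have b1 := rr_bd hn D hzx
  have b2 := rr_bd hn ((theta G)^[t] D) hzx
  have c1 : ((rr D z x + 1 : ℤ) : ZMod (Fintype.card V)) = D.1 z - D.1 y := by
    push_cast; rw [rr_cast hn, ← h0]; ring
  have k1 : rr D z y = rr D z x + 1 := by
    apply val_of hn _ _ c1 (by omega)
    rcases lt_or_eq_of_le (show rr D z x + 1 ≤ Fintype.card V by omega) with h | h
    · exact h
    · rw [h] at c1
      simp only [Int.cast_natCast, ZMod.natCast_self] at c1
      exact absurd (D.1.injective (sub_eq_zero.mp c1.symm)) hzy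
  have k2 : rr ((theta G)^[t] D) z y = rr ((theta G)^[t] D) z x - 1 := by
    apply val_of hn _ _ _ (by omega) (by omega)
    push_cast; rw [rr_cast hn]
    linear_combination -h1
  rw [hc, r0, r1] at i1
  rw [k1, k2] at i3
  have : (Fintype.card V : ℤ) * (csum G D t z y - (csum G D t z x - 1)) = 0 := by
    linear_combination i2 + i1 - i3
  rcases mul_eq_zero.mp this with h | h
  · have : Fintype.card V = 0 := by exact_mod_cast h
    omega
  · omega

lemma car_theta (G : SimpleGraph V) (D : Xi V) :
    car (theta G D) = if G.Adj (car D) (tgt D) then tgt D else car D := by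
  unfold car
  rw [theta_symm]
  split
  · next h => rw [(theta_adj G D h).2.1]; simp [tgt]
  · next h => rw [(theta_nadj G D h).2.1]; simp

lemma crs_mod (hn : 3 ≤ Fintype.card V) (D : Xi V) (z c : V) : ((crs D z c : ℤ) : ZMod 2) =
    (if z = car D then (if c = tgt D then 1 else 0) else 0) +
    (if z = tgt D then (if c = car D then 1 else 0) else 0) := by
  have h : ((eI D : ℤ) : ZMod 2) = 1 := by
    rcases eI_cases D with h | h <;> rw [h] <;> decide
  have h' : ((-eI D : ℤ) : ZMod 2) = 1 := by
    rcases eI_cases D with h | h <;> rw [h] <;> decide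
  have hct := car_ne_tgt hn D
  unfold crs
  by_cases h1 : z = car D
  · have h2 : z ≠ tgt D := by rw [h1]; exact hct
    by_cases h3 : c = tgt D
    · rw [if_pos ⟨h1, h3⟩, if_pos h1, if_pos h3, if_neg h2, h']; rfl
    · simp [h1, h3, hct]
  · by_cases h2 : z = tgt D
    · by_cases h3 : c = car D
      · rw [if_neg (fun h => h1 h.1), if_pos ⟨h2, h3⟩, if_neg h1, if_pos h2, if_pos h3, h]; rfl
      · simp [h1, h3]
    · simp [h1, h2]

noncomputable def cind (τ : V → Ty) (b : Bool) (D : Xi V) : ZMod 2 := if τ (car D) = some b then 1 else 0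

lemma cind_step (hn : 3 ≤ Fintype.card V) {G : SimpleGraph V} {τ : V → Ty} (hG : Compat G τ)
    (b : Bool) (D : Xi V) (hne : τ (car D) ≠ τ (tgt D)) :
    cind τ b (theta G D) = cind τ b D +
      ∑ z ∈ Finset.univ.filter (fun z => τ z = none),
        ∑ c ∈ Finset.univ.filter (fun c => τ c = some b), ((crs D z c : ℤ) : ZMod 2) := by
  have hA := hG _ _ (car_ne_tgt hn D)
  simp only [crs_mod hn, Finset.sum_add_distrib]
  have hs : ∀ u w : V, ∑ z ∈ Finset.univ.filter (fun z => τ z = none),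
        ∑ c ∈ Finset.univ.filter (fun c => τ c = some b),
        (if z = u then (if c = w then (1 : ZMod 2) else 0) else 0) =
        if τ u = none then (if τ w = some b then 1 else 0) else 0 := by
    intro u w
    have : ∀ z, ∑ c ∈ Finset.univ.filter (fun c => τ c = some b),
        (if z = u then (if c = w then (1 : ZMod 2) else 0) else 0) =
        if z = u then (if τ w = some b then 1 else 0) else 0 := by
      intro z
      by_cases hz : z = u
      · simp [hz, Finset.sum_ite_eq']
      · simp [hz]
    simp only [this]
    simp [Finset.sum_ite_eq']
  rw [hs, hs]
  clear hs
  unfold cind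
  rw [car_theta]
  by_cases hadj : G.Adj (car D) (tgt D)
  · rw [if_pos hadj]
    have hp := hA.mp hadj
    revert hp hne
    generalize τ (car D) = u
    generalize τ (tgt D) = w
    revert u w b
    decide
  · rw [if_neg hadj]
    have hp : passB (τ (car D)) (τ (tgt D)) = true := by
      by_contra h; exact hadj (hA.mpr (by simpa using h))
    revert hp hne
    generalize τ (car D) = u
    generalize τ (tgt D) = w
    revert u w b
    decide

lemma cind_iter (hn : 3 ≤ Fintype.card V) {G : SimpleGraph V} {τ : V → Ty} (hG : Compat G τ)
    (b : Bool) (D : Xi V) (t : ℕ)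
    (hno : ∀ k < t, τ (car ((theta G)^[k] D)) ≠ τ (tgt ((theta G)^[k] D))) :
    cind τ b ((theta G)^[t] D) = cind τ b D +
      ∑ z ∈ Finset.univ.filter (fun z => τ z = none),
        ∑ c ∈ Finset.univ.filter (fun c => τ c = some b), ((csum G D t z c : ℤ) : ZMod 2) := by
  induction t with
  | zero => simp [csum]
  | succ t ih =>
    rw [Function.iterate_succ_apply', cind_step hn hG b _ (hno t (by omega)),
      ih (fun k hk => hno k (by omega)), add_assoc, ← Finset.sum_add_distrib]
    congr 1
    apply Finset.sum_congr rfl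
    intro z _
    rw [← Finset.sum_add_distrib]
    apply Finset.sum_congr rfl
    intro c _
    unfold csum
    rw [Finset.sum_range_succ]
    push_cast
    rfl

lemma no_wrap (hn : 3 ≤ Fintype.card V) {G : SimpleGraph V} {τ : V → Ty} (hG : Compat G τ)
    (hodd : Odd (Finset.univ.filter (fun a => τ a = none)).card) (D : Xi V) (t : ℕ)
    (hno : ∀ k < t, τ (car ((theta G)^[k] D)) ≠ τ (tgt ((theta G)^[k] D))) {x y : V}
    (hxy : x ≠ y) (hτ : τ x = τ y) (h0 : D.1 x - D.1 y = 1)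
    (h1 : ((theta G)^[t] D).1 x - ((theta G)^[t] D).1 y = -1)
    (hc0 : τ (car D) = τ x) (hc1 : τ (car ((theta G)^[t] D)) = τ x) : False := by
  have hc : csum G D t x y = 0 := csum_zero G τ D t hno hτ
  have hcl : ∀ z, τ z = τ x → z = x ∨ z = y := by
    intro z hz
    by_contra hcon
    push Not at hcon
    have := odd_cross hn G D t hxy hcon.1 hcon.2 h0 h1 hc
    rw [csum_zero G τ D t hno hz, csum_zero G τ D t hno (hz.trans hτ)] at this
    omega
  have hset : Finset.univ.filter (fun z => τ z = τ x) = {x, y} := by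
    ext z
    simp only [Finset.mem_filter, Finset.mem_univ, true_and, Finset.mem_insert,
      Finset.mem_singleton]
    constructor
    · exact hcl z
    · rintro (rfl | rfl)
      · rfl
      · exact hτ.symm
  rcases hx : τ x with _ | b
  · rw [hx] at hset
    rw [hset, Finset.card_pair hxy] at hodd
    exact absurd hodd (by decide)
  · rw [hx] at hset hc0 hc1
    have := cind_iter hn hG b D t hno
    rw [hset] at this
    unfold cind at this
    rw [if_pos hc0, if_pos hc1] at this
    have hs : ∀ z ∈ Finset.univ.filter (fun z => τ z = none),
        ∑ c ∈ ({x, y} : Finset V), ((csum G D t z c : ℤ) : ZMod 2) = 1 := by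
      intro z hz
      have hz : τ z = none := (Finset.mem_filter.mp hz).2
      have hzx : z ≠ x := by rintro rfl; rw [hx] at hz; cases hz
      have hzy : z ≠ y := by rintro rfl; rw [← hτ, hx] at hz; cases hz
      rw [Finset.sum_pair hxy, odd_cross hn G D t hxy hzx hzy h0 h1 hc]
      push_cast
      generalize ((csum G D t z x : ℤ) : ZMod 2) = u
      revert u; decide
    rw [Finset.sum_congr rfl hs, Finset.sum_const, nsmul_eq_mul, mul_one] at this
    have h2 := (ZMod.natCast_eq_one_iff_odd).mpr hodd
    rw [h2] at this
    exact absurd this (by decide)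

theorem ensnaring_of (G : SimpleGraph V) (τ : V → Ty) (hG : Compat G τ)
    (hodd : Odd (Finset.univ.filter (fun a => τ a = none)).card)
    (hk : (Finset.univ.filter (fun a => τ a = none)).card + 3 ≤ Fintype.card V) :
    Ensnaring G := by
  have hn : 3 ≤ Fintype.card V := by omega
  intro D a
  obtain ⟨s, hE⟩ := exists_coll G τ hG hodd hk D
  generalize hs : (theta G)^[s] D = E at hE
  have hex := exists_coll G τ hG hodd hk (theta G E)
  obtain ⟨h, hB, hno⟩ : ∃ h, τ (car ((theta G)^[h] (theta G E))) =
      τ (tgt ((theta G)^[h] (theta G E))) ∧ ∀ k < h, τ (car ((theta G)^[k] (theta G E))) ≠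
      τ (tgt ((theta G)^[k] (theta G E))) :=
    ⟨Nat.find hex, Nat.find_spec hex, fun k hk => Nat.find_min hex hk⟩
  have hpq' : car E ≠ tgt E := car_ne_tgt hn _
  have hpq := car_ne_tgt hn ((theta G)^[h] (theta G E))
  have hA : G.Adj (car E) (tgt E) := by
    rw [hG _ _ hpq', hE, passB_self]
  have hcar0 : car (theta G E) = tgt E := by rw [car_theta, if_pos hA]
  have hd0 : (theta G E).1 (car E) - (theta G E).1 (tgt E) = ez E := by
    rw [theta_fst_apply, theta_fst_apply, Equiv.swap_apply_left, Equiv.swap_apply_right,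
      app_car, app_tgt]; ring
  have hdh : ((theta G)^[h] (theta G E)).1 (tgt ((theta G)^[h] (theta G E))) -
      ((theta G)^[h] (theta G E)).1 (car ((theta G)^[h] (theta G E))) =
      ez ((theta G)^[h] (theta G E)) := by
    rw [app_car, app_tgt]; ring
  have hT := tele hn hG D E s h hs hE hB
  have hri := rr_iter hn G (theta G E) hpq' h
  rw [csum_zero G τ _ h hno hE] at hri
  have hnw1 := fun h1 h2 h3 => no_wrap hn hG hodd (theta G E) h hno hpq' hE h1 h2
    (by rw [hcar0, hE]) h3
  have hnw2 := fun h1 h2 h3 => no_wrap hn hG hodd (theta G E) h hno hpq'.symm hE.symm h1 h2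
    (by rw [hcar0]) h3
  generalize hDh : (theta G)^[h] (theta G E) = Dh at *
  generalize hp : car Dh = p at *
  generalize hq : tgt Dh = q at *
  generalize hp' : car E = p' at *
  generalize hq' : tgt E = q' at *
  generalize dsum G (theta G E) h = d at *
  have hneg : (1 : ZMod (Fintype.card V)) ≠ -1 := by
    intro h
    have h2 : ((2 : ℕ) : ZMod (Fintype.card V)) = 0 := by
      push_cast; linear_combination h
    rw [ZMod.natCast_eq_zero_iff] at h2
    have := Nat.le_of_dvd (by norm_num) h2
    omega
  by_cases hpin : p = p' ∨ p = q'
  · by_cases hqin : q = p' ∨ q = q'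
    · -- same pair
      have hcase : (p = p' ∧ q = q') ∨ (p = q' ∧ q = p') := by
        rcases hpin with h1 | h1 <;> rcases hqin with h2 | h2
        · exact absurd (h1.trans h2.symm) hpq
        · exact Or.inl ⟨h1, h2⟩
        · exact Or.inr ⟨h1, h2⟩
        · exact absurd (h1.trans h2.symm) hpq
      have hτp : τ p = τ p' := by
        rcases hpin with h | h <;> rw [h]
        exact hE.symm
      have hτq : τ p = τ q' := hτp.trans hE
      have hdd : Dh.1 p' - Dh.1 q' = if p = p' then - ez Dh else ez Dh := by
        rcases hcase with ⟨h1, h2⟩ | ⟨h1, h2⟩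
        · rw [if_pos h1, ← hdh, h1, h2]; ring
        · rw [if_neg (by rw [h1]; exact hpq'.symm), ← hdh, h1, h2]
      -- the differences agree
      have hagree : Dh.1 p' - Dh.1 q' = ez E := by
        have hor : Dh.1 p' - Dh.1 q' = 1 ∨ Dh.1 p' - Dh.1 q' = -1 := by
          rw [hdd]; unfold ez epsZ
          split_ifs <;> simp
        have hor2 : ez E = 1 ∨ ez E = -1 := by
          unfold ez epsZ; split_ifs <;> simp
        rcases hor with h1 | h1 <;> rcases hor2 with h2 | h2
        · rw [h1, h2]
        · exfalso
          apply hnw2 (by rw [← neg_sub, hd0, h2, neg_neg]) (by rw [← neg_sub, h1]) hτq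
        · exfalso
          apply hnw1 (by rw [hd0, h2]) h1 hτp
        · rw [h1, h2]
      have hrr : rr Dh p' q' = rr (theta G E) p' q' := by
        unfold rr; rw [hagree, hd0]
      have hdeq : d p' = d q' := by
        rw [hrr] at hri; linarith
      have heI : eI E = if p = p' then - eI Dh else eI Dh := by
        rw [hagree] at hdd
        rw [← eI_cast, ← eI_cast] at hdd
        rcases eI_cases E with e1 | e1 <;> rcases eI_cases Dh with e2 | e2 <;>
          rw [e1, e2] at hdd ⊢ <;> split_ifs at hdd ⊢ <;> simp at hdd ⊢
        · exact hneg hdd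
        · exact hneg hdd
        · exact hneg hdd.symm
        · exact hneg hdd.symm
      refine hT (fun a => if a = p' then eI E else 0) ?_ ?_ a
      · simp [hpq'.symm]
      · rintro p1 q1 rfl rfl
        rcases hcase with ⟨h1, h2⟩ | ⟨h1, h2⟩
        · rw [if_pos h1] at heI
          rw [h1, h2]
          simp [hpq'.symm]; omega
        · rw [if_neg (by rw [h1]; exact hpq'.symm)] at heI
          rw [h1, h2]
          simp [hpq'.symm]; omega
    · push Not at hqin
      refine hT (fun a => if a = q then (if p = p' then eI E else 0) + (eI Dh - d q + d p)
        else if a = p' then eI E else 0) ?_ ?_ a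
      · simp [hpq'.symm, hqin.1.symm, hqin.2.symm]
      · rintro p1 q1 rfl rfl
        simp [hpq]; ring
  · push Not at hpin
    refine hT (fun a => if a = p then (if q = p' then eI E else 0) - (eI Dh - d q + d p)
      else if a = p' then eI E else 0) ?_ ?_ a
    · simp [hpq'.symm, hpin.1.symm, hpin.2.symm]
    · rintro p1 q1 rfl rfl
      simp [hpq.symm]; ring
end dyn3

section dyn4
variable {V : Type*} [Fintype V]

lemma word_data {G : SimpleGraph V} {τ : V → Ty} (hG : Compat G τ) (hn : 3 ≤ Fintype.card V)
    (D : Xi V) {a b : Ty} {r : List Ty} (h : word τ D = a :: b :: r) :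
    τ (car D) = a ∧ τ (tgt D) = b ∧
      (theta G D).2.2 = if passB a b then D.2.2 else !D.2.2 := by
  obtain ⟨r', hr⟩ := word_cons τ hn D
  rw [h] at hr
  simp only [List.cons.injEq] at hr
  obtain ⟨h1, h2, -⟩ := hr
  refine ⟨h1.symm, h2.symm, ?_⟩
  have hA := hG _ _ (car_ne_tgt hn D)
  rw [← h1, ← h2] at hA
  split
  · next hp => exact (theta_nadj G D (by rw [hA, hp]; simp)).1
  · next hp => exact (theta_adj G D (by rw [hA]; simpa using hp)).1

def MInv (τ : V → Ty) (D : Xi V) : Prop :=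
  (D.2.2 = true ∧ ∃ c Q, word τ D = SW c Q ∧ QInv Q c) ∨
  (D.2.2 = false ∧ ∃ c Y, word τ D = none :: some (!c) :: (Y.reverse ++ [some c]) ∧
    QInv (none :: Y) c) ∨
  (D.2.2 = true ∧ ∃ c Y, word τ D = some (!c) :: some c :: (Y ++ [none]) ∧ QInv (none :: Y) c)

lemma minv_step {G : SimpleGraph V} {τ : V → Ty} (hG : Compat G τ) (hn : 3 ≤ Fintype.card V)
    (D : Xi V) (h : MInv τ D) : MInv τ (theta G D) ∧ ∀ z, τ z = none → disp D z ≤ 0 := by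
  have hw := word_theta G τ hG hn D
  have hlen := word_length τ D
  have hd : ∀ z, disp D z = _ := disp_eq hn D
  rcases h with ⟨he, c, Q, hQ, hI⟩ | ⟨he, c, Y, hQ, hI⟩ | ⟨he, c, Y, hQ, hI⟩
  · rcases Q with _ | ⟨_ | d, Y⟩
    · rw [hQ] at hlen; simp [SW] at hlen; omega
    · obtain ⟨h1, h2, h3⟩ := word_data hG hn D (a := some c) (b := none) hQ
      rw [hQ, step_tr1] at hw
      refine ⟨Or.inr (Or.inl ⟨by rw [h3, he]; simp [passB], c, Y, hw, hI⟩), ?_⟩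
      intro z hz
      rw [hd, if_neg (by rintro rfl; rw [h1] at hz; cases hz), eI, he]
      split <;> simp
    · have hdc : d = !c := hI.1.1
      subst hdc
      obtain ⟨h1, h2, h3⟩ := word_data hG hn D (a := some c) (b := some (!c)) hQ
      rw [hQ, step_pass] at hw
      refine ⟨Or.inl ⟨by rw [h3, he]; cases c <;> simp [passB], c, _, hw, inv_pass c Y hI⟩, ?_⟩
      intro z hz
      rw [hd, if_neg (by rintro rfl; rw [h1] at hz; cases hz), eI, he]
      split <;> simp
  · obtain ⟨h1, h2, h3⟩ := word_data hG hn D hQ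
    rw [hQ, step_tr2] at hw
    refine ⟨Or.inr (Or.inr ⟨by rw [h3, he]; simp [passB], c, Y, hw, hI⟩), ?_⟩
    intro z hz
    have : z ≠ tgt D := by rintro rfl; rw [h2] at hz; cases hz
    rw [hd, eI, he, if_neg this]
    split <;> simp
  · obtain ⟨h1, h2, h3⟩ := word_data hG hn D hQ
    rw [hQ, step_tr3] at hw
    refine ⟨Or.inl ⟨by rw [h3, he]; cases c <;> simp [passB], !c, _, hw, inv_tr c Y hI⟩, ?_⟩
    intro z hz
    rw [hd, if_neg (by rintro rfl; rw [h1] at hz; cases hz), eI, he]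
    split <;> simp

lemma minv_iter {G : SimpleGraph V} {τ : V → Ty} (hG : Compat G τ) (hn : 3 ≤ Fintype.card V)
    (D : Xi V) (h : MInv τ D) (t : ℕ) : MInv τ ((theta G)^[t] D) := by
  induction t with
  | zero => exact h
  | succ t ih => rw [Function.iterate_succ_apply']; exact (minv_step hG hn _ ih).1

lemma not_ens {G : SimpleGraph V} {τ : V → Ty} (hG : Compat G τ) (hn : 3 ≤ Fintype.card V)
    (D : Xi V) (he : D.2.2 = true) (c : Bool) (Y : List Ty) (hw : word τ D = SW c (none :: Y))
    (hI : QInv (none :: Y) c) : ¬ Ensnaring G := by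
  intro hE
  have : NeZero (Fintype.card V) := ⟨by omega⟩
  have hM : MInv τ D := Or.inl ⟨he, c, _, hw, hI⟩
  obtain ⟨h1, h2, h3⟩ := word_data hG hn D (a := some c) (b := none) hw
  have hz := hE D (tgt D)
  have hfin : Finite (Xi V) := inferInstance
  have hper : 0 < Function.minimalPeriod (theta G) D :=
    Function.minimalPeriod_pos_of_mem_periodicPts ((theta_inj G).mem_periodicPts D)
  unfold windSum at hz
  have hlt : ∑ k ∈ Finset.range (Function.minimalPeriod (theta G) D),
      disp ((theta G)^[k] D) (tgt D) < ∑ k ∈ Finset.range (Function.minimalPeriod (theta G) D),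
      (0 : ℤ) := by
    apply Finset.sum_lt_sum
    · intro k _
      exact (minv_step hG hn _ (minv_iter hG hn D hM k)).2 _ h2
    · refine ⟨0, Finset.mem_range.mpr hper, ?_⟩
      rw [Function.iterate_zero_apply, disp_eq hn, if_neg (car_ne_tgt hn D).symm, if_pos rfl,
        eI, he]
      simp
  rw [hz] at hlt
  simp at hlt

lemma exists_word (τ : V → Ty) (hn : 3 ≤ Fintype.card V) (w : List Ty)
    (hw : ∀ x, w.count x = (Finset.univ.filter (fun a => τ a = x)).card) :
    ∃ D : Xi V, D.2.2 = true ∧ word τ D = w := by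
  have : NeZero (Fintype.card V) := ⟨by omega⟩
  let v0 : V ≃ ZMod (Fintype.card V) := Fintype.equivOfCardEq (by rw [ZMod.card])
  have hp : (word τ (v0, 0, true)).Perm w := by
    rw [List.perm_iff_count]
    intro x
    rw [hw, word_count τ hn]
  have hlen : w.length = Fintype.card V := by rw [← hp.length_eq, word_length]
  obtain ⟨e, he⟩ : ∃ e : Fin (Fintype.card V) ≃ V, ∀ j, τ (e j) = w[(j : ℕ)]'(by omega) := by
    have hf : ∀ x : Ty, Nonempty ({j : Fin (Fintype.card V) // w[(j : ℕ)]'(by omega) = x} ≃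
        {a : V // τ a = x}) := by
      intro x
      apply Nonempty.intro
      apply Fintype.equivOfCardEq
      rw [Fintype.card_subtype, Fintype.card_subtype, ← hw]
      obtain ⟨f, hf⟩ : ∃ f : Fin (Fintype.card V) → Ty, ∀ j : Fin (Fintype.card V), w[(j : ℕ)]'(by omega) = f j :=
        ⟨fun j => w[(j : ℕ)]'(by omega), fun j => rfl⟩
      have hww : w = List.ofFn f := by
        apply List.ext_getElem
        · simp [hlen]
        · intro i h1 h2
          rw [List.getElem_ofFn, ← hf]
      simp only [hf]
      rw [hww, List.ofFn_eq_map, List.count, List.countP_map, List.countP_eq_length_filter]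
      rw [← List.toFinset_card_of_nodup ((List.nodup_finRange _).filter _)]
      congr 1
      ext j; simp
    refine ⟨Equiv.ofFiberEquiv (fun x => (hf x).some), ?_⟩
    intro j
    exact Equiv.ofFiberEquiv_map _ j
  obtain ⟨z, hz⟩ : ∃ z : Fin (Fintype.card V) ≃ ZMod (Fintype.card V), ∀ j, z j = ((j : ℕ) : ZMod _) := by
    have hb : Function.Bijective (fun j : Fin (Fintype.card V) => ((j : ℕ) : ZMod (Fintype.card V))) := by
      rw [Fintype.bijective_iff_injective_and_card]
      refine ⟨?_, by simp [ZMod.card]⟩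
      intro i j h
      have h : ((i : ℕ) : ZMod (Fintype.card V)) = (j : ℕ) := h
      rw [ZMod.natCast_eq_natCast_iff', Nat.mod_eq_of_lt i.2, Nat.mod_eq_of_lt j.2] at h
      exact Fin.ext h
    exact ⟨Equiv.ofBijective _ hb, fun j => rfl⟩
  refine ⟨(e.symm.trans z, 0, true), rfl, ?_⟩
  apply List.ext_getElem
  · rw [word_length, hlen]
  · intro i h1 h2
    have hi : i < Fintype.card V := by omega
    have : z.symm (i : ZMod (Fintype.card V)) = ⟨i, hi⟩ := by
      rw [Equiv.symm_apply_eq, hz]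
    simp only [word, List.getElem_ofFn, wf, ps, ez, epsZ]
    simp only [if_true, zero_add, mul_one, Equiv.symm_trans_apply, Equiv.symm_symm]
    rw [this, he]
end dyn4

def tyf (l r n : ℕ) (a : Fin n) : Ty :=
  if (a : ℕ) < l then some true else if (a : ℕ) < l + r then some false else none

lemma tyf_compat (l r n : ℕ) : Compat (compln (l + r) n (bipartiteGraph l r)) (tyf l r n) := by
  intro a b hab
  have hab' : (a : ℕ) ≠ b := fun h => hab (Fin.ext h)
  unfold compln spread bipartiteGraph tyf
  simp only [SimpleGraph.compl_adj, SimpleGraph.fromRel_adj, ne_eq, hab, hab.symm, not_false_eq_true,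
    true_and, Fin.mk.injEq, hab', hab'.symm]
  split_ifs <;> simp [passB] <;> omega

lemma card_interval (n p q : ℕ) (hpq : p ≤ q) (hq : q ≤ n) :
    (Finset.univ.filter (fun a : Fin n => p ≤ (a : ℕ) ∧ (a : ℕ) < q)).card = q - p := by
  rw [← Nat.card_Ico, ← Finset.card_map Fin.valEmbedding]
  congr 1
  ext x
  simp only [Finset.mem_map, Finset.mem_filter, Finset.mem_univ, true_and, Fin.valEmbedding_apply,
    Finset.mem_Ico]
  constructor
  · rintro ⟨a, h, rfl⟩; exact h
  · intro h; exact ⟨⟨x, by omega⟩, h, rfl⟩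

lemma tyf_count (l r n : ℕ) (h : l + r < n) (x : Ty) :
    (Finset.univ.filter (fun a => tyf l r n a = x)).card =
      match x with
      | none => n - l - r
      | some true => l
      | some false => r := by
  rcases x with _ | _ | _
  · refine Eq.trans (congrArg Finset.card ?_) ((card_interval n (l + r) n h.le le_rfl).trans
      (show _ = n - l - r by omega))
    ext a
    have := a.2
    rw [Finset.mem_filter, Finset.mem_filter]
    unfold tyf
    split_ifs <;> simp <;> omega
  · refine Eq.trans (congrArg Finset.card ?_) ((card_interval n l (l + r) (by omega) h.le).trans
      (show _ = r by omega))
    ext a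
    have := a.2
    rw [Finset.mem_filter, Finset.mem_filter]
    unfold tyf
    split_ifs <;> simp <;> omega
  · refine Eq.trans (congrArg Finset.card ?_) ((card_interval n 0 l (by omega) (by omega)).trans
      (show _ = l by omega))
    ext a
    have := a.2
    rw [Finset.mem_filter, Finset.mem_filter]
    unfold tyf
    split_ifs <;> simp <;> omega

lemma good_rep (c : Bool) (m : ℕ) : Good c (List.replicate m (some (!c))) := by
  induction m with
  | zero => trivial
  | succ m ih => exact ⟨rfl, ih⟩

lemma not_ens_main (l r n : ℕ) (hl : 0 < l) (hr : 0 < r) (hlt : l + r < n)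
    (h : Even (n - l - r) ∨ (l = 1 ∧ r = 1)) :
    ¬ Ensnaring (compln (l + r) n (bipartiteGraph l r)) := by
  have hn : 3 ≤ Fintype.card (Fin n) := by rw [Fintype.card_fin]; omega
  obtain ⟨k, hk⟩ : ∃ k, n - l - r = k + 1 := ⟨n - l - r - 1, by omega⟩
  obtain ⟨l', rfl⟩ : ∃ l', l = l' + 1 := ⟨l - 1, by omega⟩
  obtain ⟨r', rfl⟩ : ∃ r', r = r' + 1 := ⟨r - 1, by omega⟩
  have hI : QInv (none :: (List.replicate l' (some true) ++ (List.replicate k none ++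
      List.replicate r' (some false)))) true := by
    rcases h with h | h
    · refine ⟨?_, Or.inl ?_⟩
      · have hodd : Odd k := by
          rw [hk] at h
          by_contra hc
          rw [Nat.not_odd_iff_even] at hc
          exact (Nat.not_even_iff_odd.mpr hc.add_one) h
        simp only [Good]
        rw [good_append, good_append]
        refine ⟨good_rep false l', good_all_none _ (fun x hx => List.eq_of_mem_replicate hx) _, ?_⟩
        have : tog (List.replicate k none) (tog (List.replicate l' (some true)) (!true)) = true := by
          simp [tog, List.count_replicate, hodd]
        rw [this]
        exact good_rep true r'
      · rw [hk] at h
        simpa [List.count_replicate] using h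
    · have h1 : l' = 0 := by omega
      have h2 : r' = 0 := by omega
      subst h1 h2
      have : ∀ x ∈ (none :: (List.replicate 0 (some true) ++ (List.replicate k none ++
        List.replicate 0 (some false))) : List Ty), x = none := by
        intro x hx
        simp at hx
        rcases hx with h | h
        · exact h
        · exact h.2
      exact ⟨good_all_none _ this _, Or.inr this⟩
  obtain ⟨D, hD, hw⟩ := exists_word (tyf (l' + 1) (r' + 1) n) hn (SW true (none ::
    (List.replicate l' (some true) ++ (List.replicate k none ++
      List.replicate r' (some false))))) (by
    intro x
    rw [tyf_count _ _ _ hlt]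
    rcases x with _ | _ | _
    · simp [SW, List.count_replicate, hk]
    · simp [SW, List.count_replicate]
    · simp [SW, List.count_replicate])
  exact not_ens (tyf_compat _ _ _) hn D hD _ _ hw hI

theorem stmt_17 (l r n : ℕ) (hl : 0 < l) (hr : 0 < r) (hlt : l + r < n) :
    Ensnaring (compln (l + r) n (bipartiteGraph l r)) ↔
      (Odd (n - l - r) ∧ ¬(l = 1 ∧ r = 1)) := by
  constructor
  · intro h
    by_contra hc
    refine not_ens_main l r n hl hr hlt ?_ h
    rw [← Nat.not_odd_iff_even]
    tauto
  · rintro ⟨h1, h2⟩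
    have hc := tyf_count l r n hlt none
    simp only at hc
    apply ensnaring_of _ (tyf l r n) (tyf_compat l r n)
    · rw [hc]; exact h1
    · rw [hc, Fintype.card_fin]; omega
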